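/- The set Σ = 𝒮 ∩ ℛ⁴ of unit quaternions all of whose coordinates lie in ℛ is a subgroup of the group of unit quaternions under quaternion multiplication, and it is generated as a group by Δ ∪ Δ'. -/

import Mathlib

noncomputable section

/-- The golden ratio τ = (1+√5)/2. -/
def gr : ℝ := (1 + Real.sqrt 5) / 2

/-- The H₄ root system with parameter t (t = τ gives Δ, t = 1-τ = τ' gives Δ'). -/
def DeltaSet (t : ℝ) : Set (Fin 4 → ℝ) :=
  {x | (∃ i, (x i = 1 ∨ x i = -1) ∧ ∀ j, j ≠ i → x j = 0)
    ∨ (∀ i, x i = 1/2 ∨ x i = -1/2)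
    ∨ (∃ σ : Equiv.Perm (Fin 4), Equiv.Perm.sign σ = 1 ∧
        ∃ ε : Fin 4 → ℝ, (∀ i, ε i = 1 ∨ ε i = -1) ∧
          ∀ i, x i = ε i * (![0, 1, 1 - t, t] (σ i)) / 2)}

/-- The identification of ℝ⁴ with the quaternions: (x₁,x₂,x₃,x₄) ↦ x₁ + x₂i + x₃j + x₄k. -/
def toQ (x : Fin 4 → ℝ) : Quaternion ℝ := ⟨x 0, x 1, x 2, x 3⟩

/-- Δ (t = τ) resp. Δ' (t = τ') as a set of quaternions. -/
def DeltaQ (t : ℝ) : Set (Quaternion ℝ) := toQ '' DeltaSet t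

/-- ℛ = ℤ[1/2, τ], the ring of dyadic golden numbers, as a subset of ℝ. -/
def Rgold : Set ℝ := {x : ℝ | ∃ (a b : ℤ) (n : ℕ), x = ((a : ℝ) + (b : ℝ) * gr) / 2 ^ n}

/-- Σ = 𝒮 ∩ ℛ⁴ : the unit quaternions all of whose coordinates lie in ℛ. -/
def SigmaQ : Set (Quaternion ℝ) :=
  {q | ‖q‖ = 1 ∧ q.re ∈ Rgold ∧ q.imI ∈ Rgold ∧ q.imJ ∈ Rgold ∧ q.imK ∈ Rgold}

/-- The ring `ℤ[τ]`, where `τ ^ 2 = τ + 1`. -/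
abbrev GoldenInt : Type := QuadraticAlgebra ℤ 1 1

/-- The quotient `ℤ[τ] / 2`, a field with four elements. -/
abbrev GoldenModTwo : Type := QuadraticAlgebra (ZMod 2) 1 1

namespace GoldenInt

/-- The golden ratio as an element of `ℤ[τ]`. -/
def tau : GoldenInt := ⟨0, 1⟩

theorem tau_sq : tau ^ 2 = tau + 1 := by decide

theorem star_tau : star tau = 1 - tau := by decide

/-- Reduction modulo two. -/
def red : GoldenInt →+* GoldenModTwo where
  toFun x := ⟨x.re, x.im⟩
  map_one' := by ext <;> simp [QuadraticAlgebra.re_one, QuadraticAlgebra.im_one]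
  map_zero' := by ext <;> simp
  map_mul' x y := by ext <;> simp
  map_add' x y := by ext <;> simp

/-- The evaluation `ℤ[τ] → ℝ` sending `τ` to a root `t` of `X ^ 2 - X - 1`. -/
def eval (t : ℝ) (ht : t ^ 2 = t + 1) : GoldenInt →+* ℝ where
  toFun x := x.re + x.im * t
  map_one' := by simp [QuadraticAlgebra.re_one, QuadraticAlgebra.im_one]
  map_zero' := by simp
  map_mul' x y := by
    simp only [QuadraticAlgebra.re_mul, QuadraticAlgebra.im_mul]
    push_cast
    linear_combination (-(x.im : ℝ) * y.im) * ht
  map_add' x y := by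
    simp only [QuadraticAlgebra.re_add, QuadraticAlgebra.im_add]
    push_cast
    ring

theorem eval_tau (t : ℝ) (ht : t ^ 2 = t + 1) : eval t ht tau = t := by
  simp [eval, tau]

theorem eval_star (t s : ℝ) (ht : t ^ 2 = t + 1) (hs : s ^ 2 = s + 1) (h : s = 1 - t)
    (x : GoldenInt) : eval s hs (star x) = eval t ht x := by
  subst h
  simp only [eval, RingHom.coe_mk, MonoidHom.coe_mk, OneHom.coe_mk, QuadraticAlgebra.re_star,
    QuadraticAlgebra.im_star]
  push_cast
  ring

theorem irrational_of_sq_eq (t : ℝ) (ht : t ^ 2 = t + 1) : Irrational t := by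
  have h : (t - Real.goldenRatio) * (t - Real.goldenConj) = 0 := by
    linear_combination ht - t * Real.goldenRatio_add_goldenConj + Real.goldenRatio_mul_goldenConj
  rcases mul_eq_zero.1 h with h | h
  · rw [sub_eq_zero.1 h]; exact Real.goldenRatio_irrational
  · rw [sub_eq_zero.1 h]; exact Real.goldenConj_irrational

theorem eval_injective (t : ℝ) (ht : t ^ 2 = t + 1) : Function.Injective (eval t ht) := by
  rw [injective_iff_map_eq_zero]
  intro x hx
  have h : (x.re : ℝ) + x.im * t = 0 := hx
  have him : x.im = 0 := by
    by_contra hne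
    have hirr := ((irrational_of_sq_eq t ht).intCast_mul hne).intCast_add x.re
    rw [h] at hirr
    exact hirr.ne_zero rfl
  ext
  · rw [him] at h
    simpa using h
  · exact him

theorem exists_eq_two_mul (x : GoldenInt) (hx : red x = 0) : ∃ y, x = 2 * y := by
  obtain ⟨a, ha⟩ := (ZMod.intCast_zmod_eq_zero_iff_dvd x.re 2).1 (congrArg QuadraticAlgebra.re hx)
  obtain ⟨b, hb⟩ := (ZMod.intCast_zmod_eq_zero_iff_dvd x.im 2).1 (congrArg QuadraticAlgebra.im hx)
  refine ⟨⟨a, b⟩, ?_⟩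
  ext
  · simpa [two_mul] using ha.trans (two_mul a)
  · simpa [two_mul] using hb.trans (two_mul b)

/-- The standard representative in `ℤ[τ]` of a residue class modulo two. -/
def lift (r : GoldenModTwo) : GoldenInt := ⟨r.re.val, r.im.val⟩

theorem red_lift (r : GoldenModTwo) : red (lift r) = r := by
  ext <;> simp [red, lift]

theorem exists_eq_lift_add (x : GoldenInt) : ∃ y, x = lift (red x) + 2 * y := by
  obtain ⟨y, hy⟩ := exists_eq_two_mul (x - lift (red x)) (by rw [map_sub, red_lift, sub_self])
  exact ⟨y, by rw [← hy]; ring⟩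

/-- Residues modulo two of vectors whose norm is divisible by four. -/
theorem residues_of_four_dvd : ∀ a₁ b₁ a₂ b₂ a₃ b₃ a₄ b₄ : ZMod 2,
    ((lift ⟨a₁, b₁⟩ ^ 2 + lift ⟨a₂, b₂⟩ ^ 2 + lift ⟨a₃, b₃⟩ ^ 2 + lift ⟨a₄, b₄⟩ ^ 2).re % 4 = 0 ∧
      (lift ⟨a₁, b₁⟩ ^ 2 + lift ⟨a₂, b₂⟩ ^ 2 + lift ⟨a₃, b₃⟩ ^ 2 + lift ⟨a₄, b₄⟩ ^ 2).im % 4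
        = 0) →
    ((⟨a₃, b₃⟩ : GoldenModTwo) = ⟨a₁, b₁⟩ + ⟨1, 1⟩ * (⟨a₂, b₂⟩ - ⟨a₁, b₁⟩) ∧
      (⟨a₄, b₄⟩ : GoldenModTwo) = ⟨a₁, b₁⟩ + ⟨0, 1⟩ * (⟨a₂, b₂⟩ - ⟨a₁, b₁⟩)) ∨
    ((⟨a₃, b₃⟩ : GoldenModTwo) = ⟨a₁, b₁⟩ + ⟨0, 1⟩ * (⟨a₂, b₂⟩ - ⟨a₁, b₁⟩) ∧
      (⟨a₄, b₄⟩ : GoldenModTwo) = ⟨a₁, b₁⟩ + ⟨1, 1⟩ * (⟨a₂, b₂⟩ - ⟨a₁, b₁⟩)) := by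
  decide +kernel

theorem red_eq_of_four_dvd (x₁ x₂ x₃ x₄ m : GoldenInt)
    (h : x₁ ^ 2 + x₂ ^ 2 + x₃ ^ 2 + x₄ ^ 2 = 4 * m) :
    (red x₃ = red (x₁ + (1 - tau) * (x₂ - x₁)) ∧ red x₄ = red (x₁ + tau * (x₂ - x₁))) ∨
    (red x₃ = red (x₁ + tau * (x₂ - x₁)) ∧ red x₄ = red (x₁ + (1 - tau) * (x₂ - x₁))) := by
  obtain ⟨y₁, h₁⟩ := exists_eq_lift_add x₁
  obtain ⟨y₂, h₂⟩ := exists_eq_lift_add x₂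
  obtain ⟨y₃, h₃⟩ := exists_eq_lift_add x₃
  obtain ⟨y₄, h₄⟩ := exists_eq_lift_add x₄
  obtain ⟨k, hk⟩ : ∃ k, lift (red x₁) ^ 2 + lift (red x₂) ^ 2 + lift (red x₃) ^ 2
      + lift (red x₄) ^ 2 = 4 * k := by
    refine ⟨m - (lift (red x₁) * y₁ + y₁ ^ 2) - (lift (red x₂) * y₂ + y₂ ^ 2)
      - (lift (red x₃) * y₃ + y₃ ^ 2) - (lift (red x₄) * y₄ + y₄ ^ 2), ?_⟩
    linear_combination h - (x₁ + lift (red x₁) + 2 * y₁) * h₁ - (x₂ + lift (red x₂) + 2 * y₂) * h₂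
      - (x₃ + lift (red x₃) + 2 * y₃) * h₃ - (x₄ + lift (red x₄) + 2 * y₄) * h₄
  have hred : red (1 - tau) = ⟨1, 1⟩ := by decide
  have hred' : red tau = ⟨0, 1⟩ := by decide
  simp only [map_add, map_mul, map_sub red x₂ x₁, hred, hred']
  apply residues_of_four_dvd
  have h4 : (4 : GoldenInt) = ⟨4, 0⟩ := by decide
  change (lift (red x₁) ^ 2 + lift (red x₂) ^ 2 + lift (red x₃) ^ 2 + lift (red x₄) ^ 2).re % 4 = 0
    ∧ (lift (red x₁) ^ 2 + lift (red x₂) ^ 2 + lift (red x₃) ^ 2 + lift (red x₄) ^ 2).im % 4 = 0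
  rw [hk, h4]
  simp

end GoldenInt

namespace Icosian

variable {R : Type*} [CommRing R]

/-- Twice the quaternion coordinates of the icosian with coordinate vector `c`, with respect to the
basis `(1 + i + j + k) / 2`, `(i + (1 - t) j + t k) / 2`, `j`, `k`. -/
def coords (t : R) (c : R × R × R × R) : R × R × R × R :=
  (c.1, c.1 + c.2.1, c.1 + (1 - t) * c.2.1 + 2 * c.2.2.1, c.1 + t * c.2.1 + 2 * c.2.2.2)

/-- The norm form of the icosian ring. -/
def normForm (t : R) (c : R × R × R × R) : R :=
  c.1 ^ 2 + c.2.1 ^ 2 + c.2.2.1 ^ 2 + c.2.2.2 ^ 2 + c.1 * c.2.1 + c.1 * c.2.2.1 + c.1 * c.2.2.2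
    + (1 - t) * (c.2.1 * c.2.2.1) + t * (c.2.1 * c.2.2.2)

/-- Left multiplication by `(t + i + (1 - t) k) / 2`, in coordinates. -/
def mulLeft (t : R) (c : R × R × R × R) : R × R × R × R :=
  ((t - 1) * c.1 + (t - 1) * c.2.2.2,
    c.1 + (t - 1) * c.2.1 + (t - 1) * c.2.2.1 + (1 - t) * c.2.2.2,
    (1 - t) * c.2.1 + c.2.2.1 - c.2.2.2,
    (1 - t) * c.1 + c.2.2.2)

/-- Right multiplication by `(t + i + (1 - t) k) / 2`, in coordinates. -/
def mulRight (t : R) (c : R × R × R × R) : R × R × R × R :=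
  ((t - 1) * c.1 + (t - 1) * c.2.2.2,
    (2 - t) * c.1 + c.2.1 + (1 - t) * c.2.2.1 + (1 - t) * c.2.2.2,
    (t - 1) * c.1 + (t - 1) * c.2.1 + (t - 1) * c.2.2.1,
    (1 - t) * c.1 + c.2.2.2)

theorem four_mul_normForm (t : R) (ht : t ^ 2 = t + 1) (c : R × R × R × R) :
    (coords t c).1 ^ 2 + (coords t c).2.1 ^ 2 + (coords t c).2.2.1 ^ 2 + (coords t c).2.2.2 ^ 2
      = 4 * normForm t c := by
  simp only [coords, normForm]
  linear_combination (2 * c.2.1 ^ 2) * ht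

/-- Modulo two, every icosian of norm `0` or `1` becomes a quaternion with coordinates in `ℤ[τ]`
after multiplying on both sides by suitable icosian units. -/
theorem exists_mul_eq_zero_mod_two : ∀ a₁ b₁ a₂ b₂ a₃ b₃ a₄ b₄ : ZMod 2,
    (normForm (⟨0, 1⟩ : GoldenModTwo) (⟨a₁, b₁⟩, ⟨a₂, b₂⟩, ⟨a₃, b₃⟩, ⟨a₄, b₄⟩)).im = 0 →
    ∃ a b : Fin 5,
      ((mulLeft (⟨0, 1⟩ : GoldenModTwo))^[a] ((mulRight ⟨0, 1⟩)^[b]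
        (⟨a₁, b₁⟩, ⟨a₂, b₂⟩, ⟨a₃, b₃⟩, ⟨a₄, b₄⟩))).1 = 0 ∧
      ((mulLeft (⟨0, 1⟩ : GoldenModTwo))^[a] ((mulRight ⟨0, 1⟩)^[b]
        (⟨a₁, b₁⟩, ⟨a₂, b₂⟩, ⟨a₃, b₃⟩, ⟨a₄, b₄⟩))).2.1 = 0 := by
  decide +kernel

/-- Entrywise application of a ring homomorphism. -/
def mapVec {S : Type*} [CommRing S] (f : R →+* S) (c : R × R × R × R) : S × S × S × S :=
  (f c.1, f c.2.1, f c.2.2.1, f c.2.2.2)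

section

variable {S : Type*} [CommRing S] (f : R →+* S) (t : R) (c : R × R × R × R)

theorem mapVec_mulLeft : mapVec f (mulLeft t c) = mulLeft (f t) (mapVec f c) := by
  simp [mapVec, mulLeft]

theorem mapVec_mulRight : mapVec f (mulRight t c) = mulRight (f t) (mapVec f c) := by
  simp [mapVec, mulRight, map_ofNat f 2]

theorem map_normForm : f (normForm t c) = normForm (f t) (mapVec f c) := by
  simp [mapVec, normForm]

end

/-- The quaternion with coordinate vector `c / 2`. -/
def halfQ (c : ℝ × ℝ × ℝ × ℝ) : Quaternion ℝ := ⟨c.1 / 2, c.2.1 / 2, c.2.2.1 / 2, c.2.2.2 / 2⟩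

variable (t : ℝ) (c : ℝ × ℝ × ℝ × ℝ)

theorem halfQ_coords_mulLeft (ht : t ^ 2 = t + 1) :
    halfQ (coords t (mulLeft t c)) = halfQ (t, 1, 0, 1 - t) * halfQ (coords t c) := by
  ext <;> simp only [Quaternion.re_mul, Quaternion.imI_mul, Quaternion.imJ_mul,
    Quaternion.imK_mul] <;> simp only [halfQ, coords, mulLeft] <;> grind

theorem halfQ_coords_mulRight (ht : t ^ 2 = t + 1) :
    halfQ (coords t (mulRight t c)) = halfQ (coords t c) * halfQ (t, 1, 0, 1 - t) := by
  ext <;> simp only [Quaternion.re_mul, Quaternion.imI_mul, Quaternion.imJ_mul,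
    Quaternion.imK_mul] <;> simp only [halfQ, coords, mulRight] <;> grind

end Icosian

theorem gr_sq : gr ^ 2 = gr + 1 := by
  have h : Real.sqrt 5 ^ 2 = 5 := Real.sq_sqrt (by norm_num)
  unfold gr
  linear_combination h / 4

theorem one_sub_gr_sq : (1 - gr) ^ 2 = (1 - gr) + 1 := by
  linear_combination gr_sq

theorem norm_eq_one_iff_normSq (q : Quaternion ℝ) : ‖q‖ = 1 ↔ Quaternion.normSq q = 1 := by
  rw [Quaternion.normSq_eq_norm_mul_self, ← sq,
    pow_eq_one_iff_of_nonneg (norm_nonneg q) two_ne_zero]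

theorem mem_Rgold_iff (x : ℝ) :
    x ∈ Rgold ↔ ∃ (y : GoldenInt) (n : ℕ), x = GoldenInt.eval gr gr_sq y / 2 ^ n :=
  ⟨fun ⟨a, b, n, h⟩ => ⟨⟨a, b⟩, n, h⟩, fun ⟨y, n, h⟩ => ⟨y.re, y.im, n, h⟩⟩

/-- `ℤ[1/2, τ]` as a subring of `ℝ`. -/
def dyadicGolden : Subring ℝ where
  carrier := Rgold
  one_mem' := (mem_Rgold_iff 1).2 ⟨1, 0, by simp⟩
  zero_mem' := (mem_Rgold_iff 0).2 ⟨0, 0, by simp⟩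
  mul_mem' {x y} hx hy := by
    obtain ⟨a, m, rfl⟩ := (mem_Rgold_iff x).1 hx
    obtain ⟨b, n, rfl⟩ := (mem_Rgold_iff y).1 hy
    exact (mem_Rgold_iff _).2 ⟨a * b, m + n, by rw [map_mul, pow_add, div_mul_div_comm]⟩
  add_mem' {x y} hx hy := by
    obtain ⟨a, m, rfl⟩ := (mem_Rgold_iff x).1 hx
    obtain ⟨b, n, rfl⟩ := (mem_Rgold_iff y).1 hy
    refine (mem_Rgold_iff _).2 ⟨a * 2 ^ n + 2 ^ m * b, m + n, ?_⟩
    rw [div_add_div _ _ (by positivity) (by positivity), pow_add]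
    simp [map_ofNat (GoldenInt.eval gr gr_sq) 2]
  neg_mem' {x} hx := by
    obtain ⟨a, m, rfl⟩ := (mem_Rgold_iff x).1 hx
    exact (mem_Rgold_iff _).2 ⟨-a, m, by rw [map_neg, neg_div]⟩

theorem gr_mem_dyadicGolden : gr ∈ dyadicGolden := ⟨0, 1, 0, by simp⟩

theorem half_mem_dyadicGolden : (1 / 2 : ℝ) ∈ dyadicGolden := ⟨1, 0, 1, by simp⟩

theorem one_mem_SigmaQ : (1 : Quaternion ℝ) ∈ SigmaQ :=
  ⟨norm_one, dyadicGolden.one_mem, dyadicGolden.zero_mem, dyadicGolden.zero_mem,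
    dyadicGolden.zero_mem⟩

theorem mul_mem_SigmaQ {x y : Quaternion ℝ} (hx : x ∈ SigmaQ) (hy : y ∈ SigmaQ) :
    x * y ∈ SigmaQ := by
  obtain ⟨hx, x₁, x₂, x₃, x₄⟩ := hx
  obtain ⟨hy, y₁, y₂, y₃, y₄⟩ := hy
  change _ ∈ dyadicGolden at x₁ x₂ x₃ x₄ y₁ y₂ y₃ y₄
  refine ⟨by rw [norm_mul, hx, hy, one_mul], ?_, ?_, ?_, ?_⟩ <;> change _ ∈ dyadicGolden
  · rw [Quaternion.re_mul]
    exact sub_mem (sub_mem (sub_mem (mul_mem x₁ y₁) (mul_mem x₂ y₂)) (mul_mem x₃ y₃))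
      (mul_mem x₄ y₄)
  · rw [Quaternion.imI_mul]
    exact sub_mem (add_mem (add_mem (mul_mem x₁ y₂) (mul_mem x₂ y₁)) (mul_mem x₃ y₄))
      (mul_mem x₄ y₃)
  · rw [Quaternion.imJ_mul]
    exact add_mem (add_mem (sub_mem (mul_mem x₁ y₃) (mul_mem x₂ y₄)) (mul_mem x₃ y₁))
      (mul_mem x₄ y₂)
  · rw [Quaternion.imK_mul]
    exact add_mem (sub_mem (add_mem (mul_mem x₁ y₄) (mul_mem x₂ y₃)) (mul_mem x₃ y₂))
      (mul_mem x₄ y₁)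

theorem inv_mem_SigmaQ {x : Quaternion ℝ} (hx : x ∈ SigmaQ) : x⁻¹ ∈ SigmaQ := by
  obtain ⟨hx, x₁, x₂, x₃, x₄⟩ := hx
  have hinv : x⁻¹ = star x := by
    rw [Quaternion.inv_def, (norm_eq_one_iff_normSq x).1 hx, inv_one, one_smul]
  rw [hinv]
  exact ⟨by rw [norm_star, hx], by rwa [Quaternion.re_star],
    by rw [Quaternion.imI_star]; exact dyadicGolden.neg_mem x₂,
    by rw [Quaternion.imJ_star]; exact dyadicGolden.neg_mem x₃,
    by rw [Quaternion.imK_star]; exact dyadicGolden.neg_mem x₄⟩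

/-- The unit quaternions with dyadic golden coordinates, as a group. -/
def sigmaSubgroup : Subgroup (Quaternion ℝ)ˣ where
  carrier := {u | (u : Quaternion ℝ) ∈ SigmaQ}
  one_mem' := one_mem_SigmaQ
  mul_mem' hx hy := by
    rw [Set.mem_ofPred_eq, Units.val_mul]
    exact mul_mem_SigmaQ hx hy
  inv_mem' hx := by
    rw [Set.mem_ofPred_eq, Units.val_inv_eq_inv_val]
    exact inv_mem_SigmaQ hx

theorem toQ_mem_SigmaQ {x : Fin 4 → ℝ} (hx : ∀ i, x i ∈ dyadicGolden) (h : ∑ i, x i ^ 2 = 1) :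
    toQ x ∈ SigmaQ := by
  refine ⟨?_, hx 0, hx 1, hx 2, hx 3⟩
  rw [norm_eq_one_iff_normSq, Quaternion.normSq_def']
  rw [Fin.sum_univ_four] at h
  exact h

theorem DeltaQ_subset_SigmaQ (t : ℝ) (ht : t ^ 2 = t + 1) (htm : t ∈ dyadicGolden) :
    DeltaQ t ⊆ SigmaQ := by
  rintro _ ⟨x, hx, rfl⟩
  rcases hx with ⟨i, hi, hj⟩ | hx | ⟨σ, -, ε, hε, hx⟩
  · apply toQ_mem_SigmaQ
    · intro j
      by_cases hji : j = i
      · subst hji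
        rcases hi with hi | hi <;> rw [hi]
        exacts [one_mem _, neg_mem (one_mem _)]
      · rw [hj j hji]
        exact zero_mem _
    · rw [Finset.sum_eq_single i (fun j _ h => by rw [hj j h]; norm_num) (by simp)]
      rcases hi with hi | hi <;> rw [hi] <;> norm_num
  · apply toQ_mem_SigmaQ
    · intro i
      rcases hx i with h | h <;> rw [h]
      · exact half_mem_dyadicGolden
      · rw [neg_div]
        exact neg_mem half_mem_dyadicGolden
    · have hsq : ∀ i, x i ^ 2 = 1 / 4 := fun i => by
        rcases hx i with h | h <;> rw [h] <;> norm_num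
      simp [hsq]
  · apply toQ_mem_SigmaQ
    · intro i
      have hv : ∀ j : Fin 4, (![0, 1, 1 - t, t] j : ℝ) ∈ dyadicGolden := by
        intro j
        fin_cases j
        exacts [zero_mem _, one_mem _, sub_mem (one_mem _) htm, htm]
      rw [hx i, div_eq_mul_one_div]
      refine mul_mem (mul_mem ?_ (hv _)) half_mem_dyadicGolden
      rcases hε i with h | h <;> rw [h]
      exacts [one_mem _, neg_mem (one_mem _)]
    · have hsq : ∀ i, x i ^ 2 = ![0, 1, 1 - t, t] (σ i) ^ 2 / 4 := fun i => by
        rw [hx i]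
        rcases hε i with h | h <;> rw [h] <;> ring
      simp only [hsq]
      rw [Equiv.sum_comp σ (fun j => (![0, 1, 1 - t, t] j : ℝ) ^ 2 / 4), Fin.sum_univ_four]
      simp
      linear_combination ht / 2

/-- The group generated by the two root systems. -/
def rootGroup : Subgroup (Quaternion ℝ)ˣ :=
  Subgroup.closure {u : (Quaternion ℝ)ˣ | (u : Quaternion ℝ) ∈ DeltaQ gr ∪ DeltaQ (1 - gr)}

theorem mem_rootGroup {t : ℝ} (ht : t = gr ∨ t = 1 - gr) {u : (Quaternion ℝ)ˣ}
    (hu : (u : Quaternion ℝ) ∈ DeltaQ t) : u ∈ rootGroup := by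
  apply Subgroup.subset_closure
  rcases ht with rfl | rfl
  exacts [Or.inl hu, Or.inr hu]

theorem rootGroup_le_sigmaSubgroup : rootGroup ≤ sigmaSubgroup := by
  refine (Subgroup.closure_le _).2 ?_
  rintro u (hu | hu)
  · exact DeltaQ_subset_SigmaQ gr gr_sq gr_mem_dyadicGolden hu
  · exact DeltaQ_subset_SigmaQ (1 - gr) one_sub_gr_sq
      (sub_mem (one_mem _) gr_mem_dyadicGolden) hu

namespace Icosian

theorem halfQ_tau_mem_DeltaQ (t : ℝ) : halfQ (t, 1, 0, 1 - t) ∈ DeltaQ t := by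
  refine ⟨![t / 2, 1 / 2, 0 / 2, (1 - t) / 2], Or.inr (Or.inr ⟨Equiv.swap 0 2 * Equiv.swap 0 3,
    by decide, fun _ => 1, fun _ => Or.inl rfl, ?_⟩), rfl⟩
  have h0 : (Equiv.swap 0 2 * Equiv.swap 0 3 : Equiv.Perm (Fin 4)) 0 = 3 := by decide
  have h1 : (Equiv.swap 0 2 * Equiv.swap 0 3 : Equiv.Perm (Fin 4)) 1 = 1 := by decide
  have h2 : (Equiv.swap 0 2 * Equiv.swap 0 3 : Equiv.Perm (Fin 4)) 2 = 0 := by decide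
  have h3 : (Equiv.swap 0 2 * Equiv.swap 0 3 : Equiv.Perm (Fin 4)) 3 = 2 := by decide
  intro i
  fin_cases i <;> simp [h0, h1, h2, h3]

theorem normSq_eq_one_of_mem_DeltaQ {t : ℝ} (ht : t = gr ∨ t = 1 - gr) {q : Quaternion ℝ}
    (hq : q ∈ DeltaQ t) : Quaternion.normSq q = 1 := by
  rw [← norm_eq_one_iff_normSq]
  rcases ht with rfl | rfl
  · exact (DeltaQ_subset_SigmaQ gr gr_sq gr_mem_dyadicGolden hq).1
  · exact (DeltaQ_subset_SigmaQ (1 - gr) one_sub_gr_sq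
      (sub_mem (one_mem _) gr_mem_dyadicGolden) hq).1

theorem exists_unit_of_mem_DeltaQ {t : ℝ} (ht : t = gr ∨ t = 1 - gr) {q : Quaternion ℝ}
    (hq : q ∈ DeltaQ t) : ∃ u ∈ rootGroup, (u : Quaternion ℝ) = q := by
  have hne : q ≠ 0 := by
    rintro rfl
    simpa using normSq_eq_one_of_mem_DeltaQ ht hq
  exact ⟨Units.mk0 q hne, mem_rootGroup ht hq, rfl⟩

/-- The quaternion with a given coordinate vector. -/
def vecQ (c : ℝ × ℝ × ℝ × ℝ) : Quaternion ℝ := ⟨c.1, c.2.1, c.2.2.1, c.2.2.2⟩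

theorem normSq_vecQ (c : ℝ × ℝ × ℝ × ℝ) :
    Quaternion.normSq (vecQ c) = c.1 ^ 2 + c.2.1 ^ 2 + c.2.2.1 ^ 2 + c.2.2.2 ^ 2 :=
  Quaternion.normSq_def' _

theorem mapVec_coords {R S : Type*} [CommRing R] [CommRing S] (f : R →+* S) (t : R)
    (c : R × R × R × R) : mapVec f (coords t c) = coords (f t) (mapVec f c) := by
  simp [mapVec, coords, map_ofNat f 2]

theorem exists_eq_one_of_sum_sq : ∀ a ∈ Finset.Icc (-1 : ℤ) 1, ∀ b ∈ Finset.Icc (-1 : ℤ) 1,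
    ∀ c ∈ Finset.Icc (-1 : ℤ) 1, ∀ d ∈ Finset.Icc (-1 : ℤ) 1,
    a ^ 2 + b ^ 2 + c ^ 2 + d ^ 2 = 1 →
    ∃ i : Fin 4, (![a, b, c, d] i = 1 ∨ ![a, b, c, d] i = -1) ∧
      ∀ j, j ≠ i → ![a, b, c, d] j = 0 := by
  decide +kernel

theorem vecQ_mem_DeltaQ_of_sum_sq (t : ℝ) (ht : t ^ 2 = t + 1)
    (x : GoldenInt × GoldenInt × GoldenInt × GoldenInt)
    (hx : x.1 ^ 2 + x.2.1 ^ 2 + x.2.2.1 ^ 2 + x.2.2.2 ^ 2 = 1) :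
    vecQ (mapVec (GoldenInt.eval t ht) x) ∈ DeltaQ t := by
  obtain ⟨⟨a₁, b₁⟩, ⟨a₂, b₂⟩, ⟨a₃, b₃⟩, ⟨a₄, b₄⟩⟩ := x
  have hre := congrArg QuadraticAlgebra.re hx
  have him := congrArg QuadraticAlgebra.im hx
  simp [sq, QuadraticAlgebra.re_one, QuadraticAlgebra.im_one] at hre him
  have hb : b₁ ^ 2 + b₂ ^ 2 + b₃ ^ 2 + b₄ ^ 2 = 0 := by
    have h₁ : b₁ ^ 2 + b₂ ^ 2 + b₃ ^ 2 + b₄ ^ 2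
        = 2 * -(a₁ * b₁ + a₂ * b₂ + a₃ * b₃ + a₄ * b₄) := by linear_combination him
    have h₂ : 0 ≤ b₁ ^ 2 + b₂ ^ 2 + b₃ ^ 2 + b₄ ^ 2 := by positivity
    have h₃ : 0 ≤ a₁ ^ 2 + a₂ ^ 2 + a₃ ^ 2 + a₄ ^ 2 := by positivity
    have h₄ : b₁ ^ 2 + b₂ ^ 2 + b₃ ^ 2 + b₄ ^ 2 + (a₁ ^ 2 + a₂ ^ 2 + a₃ ^ 2 + a₄ ^ 2) = 1 := by
      linear_combination hre
    omega
  have hb₁ : b₁ = 0 := by nlinarith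
  have hb₂ : b₂ = 0 := by nlinarith
  have hb₃ : b₃ = 0 := by nlinarith
  have hb₄ : b₄ = 0 := by nlinarith
  subst hb₁ hb₂ hb₃ hb₄
  have ha : a₁ ^ 2 + a₂ ^ 2 + a₃ ^ 2 + a₄ ^ 2 = 1 := by linear_combination hre
  have hle : ∀ a b c d : ℤ, a ^ 2 + b ^ 2 + c ^ 2 + d ^ 2 = 1 → a ∈ Finset.Icc (-1 : ℤ) 1 := by
    intro a b c d h
    rw [Finset.mem_Icc]
    constructor <;> nlinarith [sq_nonneg b, sq_nonneg c, sq_nonneg d]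
  obtain ⟨i, hi, hj⟩ := exists_eq_one_of_sum_sq a₁ (hle a₁ a₂ a₃ a₄ ha)
    a₂ (hle a₂ a₁ a₃ a₄ (by linarith)) a₃ (hle a₃ a₂ a₁ a₄ (by linarith))
    a₄ (hle a₄ a₂ a₃ a₁ (by linarith)) ha
  refine ⟨fun j => ((![a₁, a₂, a₃, a₄] j : ℤ) : ℝ), Or.inl ⟨i, ?_, fun j hji => ?_⟩, ?_⟩
  · rcases hi with hi | hi
    · left; simp only [hi]; norm_num
    · right; simp only [hi]; norm_num
  · simp only [hj j hji]; norm_num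
  · ext <;> simp [toQ, vecQ, mapVec, GoldenInt.eval]

/-- The step of the descent: an icosian divided by `2 ^ n` lies in the group, provided that
this holds for all vectors with coordinates in `ℤ[τ]` divided by `2 ^ n`. -/
theorem mem_rootGroup_of_smul_eq_halfQ {t : ℝ} (ht : t = gr ∨ t = 1 - gr) (hts : t ^ 2 = t + 1)
    (n : ℕ)
    (ih : ∀ q : (Quaternion ℝ)ˣ, Quaternion.normSq (q : Quaternion ℝ) = 1 →
      ∀ x, (2 ^ n : ℝ) • (q : Quaternion ℝ) = vecQ (mapVec (GoldenInt.eval t hts) x) →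
        q ∈ rootGroup)
    (q : (Quaternion ℝ)ˣ) (hq : Quaternion.normSq (q : Quaternion ℝ) = 1)
    (c : GoldenInt × GoldenInt × GoldenInt × GoldenInt)
    (hc : (2 ^ n : ℝ) • (q : Quaternion ℝ)
      = halfQ (mapVec (GoldenInt.eval t hts) (coords GoldenInt.tau c)))
    (hN : normForm GoldenInt.tau c = 4 ^ n) : q ∈ rootGroup := by
  obtain ⟨g, hg, hgv⟩ := exists_unit_of_mem_DeltaQ ht (halfQ_tau_mem_DeltaQ t)
  have hgn := normSq_eq_one_of_mem_DeltaQ ht (halfQ_tau_mem_DeltaQ t)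
  have hτ : GoldenInt.red GoldenInt.tau = ⟨0, 1⟩ := by decide
  have hN₂ : (normForm (⟨0, 1⟩ : GoldenModTwo) (mapVec GoldenInt.red c)).im = 0 := by
    have h4 : GoldenInt.red 4 = 0 := by decide
    rw [← hτ, ← map_normForm, hN, map_pow, h4]
    cases n <;> simp [QuadraticAlgebra.im_one]
  obtain ⟨a, b, h₁, h₂⟩ := exists_mul_eq_zero_mod_two _ _ _ _ _ _ _ _ hN₂
  have hL : Function.Semiconj (mapVec GoldenInt.red) (mulLeft GoldenInt.tau) (mulLeft ⟨0, 1⟩) :=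
    fun c => by rw [mapVec_mulLeft, hτ]
  have hR : Function.Semiconj (mapVec GoldenInt.red) (mulRight GoldenInt.tau) (mulRight ⟨0, 1⟩) :=
    fun c => by rw [mapVec_mulRight, hτ]
  obtain ⟨d, hd⟩ : ∃ d, d = (mulLeft GoldenInt.tau)^[a] ((mulRight GoldenInt.tau)^[b] c) := ⟨_, rfl⟩
  have hdred : mapVec GoldenInt.red d = (mulLeft ⟨0, 1⟩)^[a] ((mulRight ⟨0, 1⟩)^[b]
      (mapVec GoldenInt.red c)) := by
    rw [hd, (hL.iterate_right a).eq, (hR.iterate_right b).eq]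
  obtain ⟨u₁, hu₁⟩ := GoldenInt.exists_eq_two_mul d.1 ((congrArg Prod.fst hdred).trans h₁)
  obtain ⟨u₂, hu₂⟩ := GoldenInt.exists_eq_two_mul d.2.1
    ((congrArg (fun p => p.2.1) hdred).trans h₂)
  let I : GoldenInt × GoldenInt × GoldenInt × GoldenInt → Quaternion ℝ :=
    fun c => halfQ (mapVec (GoldenInt.eval t hts) (coords GoldenInt.tau c))
  have hI : ∀ c, I c = halfQ (coords t (mapVec (GoldenInt.eval t hts) c)) := fun c => by
    simp only [I]
    rw [mapVec_coords, GoldenInt.eval_tau]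
  have hIL : Function.Semiconj I (mulLeft GoldenInt.tau) ((g : Quaternion ℝ) * ·) := fun c => by
    rw [hI, hI, mapVec_mulLeft, GoldenInt.eval_tau, halfQ_coords_mulLeft _ _ hts, hgv]
  have hIR : Function.Semiconj I (mulRight GoldenInt.tau) (· * (g : Quaternion ℝ)) := fun c => by
    rw [hI, hI, mapVec_mulRight, GoldenInt.eval_tau, halfQ_coords_mulRight _ _ hts, hgv]
  have hId : I d = (g : Quaternion ℝ) ^ (a : ℕ) * (I c * (g : Quaternion ℝ) ^ (b : ℕ)) := by
    rw [hd, (hIL.iterate_right a).eq, (hIR.iterate_right b).eq,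
      mul_left_iterate, mul_right_iterate]
  have hIx : I d = vecQ (mapVec (GoldenInt.eval t hts) (u₁, u₁ + u₂,
      u₁ + (1 - GoldenInt.tau) * u₂ + d.2.2.1, u₁ + GoldenInt.tau * u₂ + d.2.2.2)) := by
    simp only [I]
    ext <;> simp only [halfQ, vecQ, mapVec, coords, hu₁, hu₂, map_add, map_mul,
      map_ofNat (GoldenInt.eval t hts) 2] <;> ring
  have hmem := ih (g ^ (a : ℕ) * (q * g ^ (b : ℕ)))
    (by simp [hgv, hgn, hq]) _ (by
      rw [← hIx, hId]
      simp only [I]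
      rw [← hc]
      simp)
  rwa [Subgroup.mul_mem_cancel_left _ (pow_mem hg _),
    Subgroup.mul_mem_cancel_right _ (pow_mem hg _)] at hmem

theorem mem_rootGroup_of_red_eq {t : ℝ} (ht : t = gr ∨ t = 1 - gr) (hts : t ^ 2 = t + 1)
    (n : ℕ)
    (ih : ∀ q : (Quaternion ℝ)ˣ, Quaternion.normSq (q : Quaternion ℝ) = 1 →
      ∀ x, (2 ^ n : ℝ) • (q : Quaternion ℝ) = vecQ (mapVec (GoldenInt.eval t hts) x) →
        q ∈ rootGroup)
    (q : (Quaternion ℝ)ˣ) (hq : Quaternion.normSq (q : Quaternion ℝ) = 1)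
    (x₁ x₂ x₃ x₄ : GoldenInt)
    (hx : (2 ^ (n + 1) : ℝ) • (q : Quaternion ℝ)
      = vecQ (mapVec (GoldenInt.eval t hts) (x₁, x₂, x₃, x₄)))
    (h₃ : GoldenInt.red x₃ = GoldenInt.red (x₁ + (1 - GoldenInt.tau) * (x₂ - x₁)))
    (h₄ : GoldenInt.red x₄ = GoldenInt.red (x₁ + GoldenInt.tau * (x₂ - x₁))) :
    q ∈ rootGroup := by
  obtain ⟨y₃, hy₃⟩ := GoldenInt.exists_eq_two_mul
    (x₃ - (x₁ + (1 - GoldenInt.tau) * (x₂ - x₁))) (by rw [map_sub, h₃, sub_self])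
  obtain ⟨y₄, hy₄⟩ := GoldenInt.exists_eq_two_mul
    (x₄ - (x₁ + GoldenInt.tau * (x₂ - x₁))) (by rw [map_sub, h₄, sub_self])
  have hcoords : coords GoldenInt.tau (x₁, x₂ - x₁, y₃, y₄) = (x₁, x₂, x₃, x₄) := by
    simp only [coords, ← hy₃, ← hy₄, add_sub_cancel]
  have hhalf : (2 ^ n : ℝ) • (q : Quaternion ℝ)
      = halfQ (mapVec (GoldenInt.eval t hts) (x₁, x₂, x₃, x₄)) := by
    have h := congrArg (fun p : Quaternion ℝ => (1 / 2 : ℝ) • p) hx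
    simp only [smul_smul] at h
    rw [show (1 / 2 : ℝ) * 2 ^ (n + 1) = 2 ^ n by ring] at h
    rw [h]
    ext <;> simp only [Quaternion.re_smul, Quaternion.imI_smul, Quaternion.imJ_smul,
      Quaternion.imK_smul, smul_eq_mul] <;> simp only [vecQ, halfQ] <;> ring
  refine mem_rootGroup_of_smul_eq_halfQ ht hts n ih q hq (x₁, x₂ - x₁, y₃, y₄)
    (by rw [hcoords]; exact hhalf) ?_
  apply GoldenInt.eval_injective t hts
  have hnorm := congrArg Quaternion.normSq hx
  rw [normSq_vecQ, Quaternion.normSq_smul, hq] at hnorm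
  have h4 := congrArg (GoldenInt.eval t hts)
    (four_mul_normForm GoldenInt.tau GoldenInt.tau_sq (x₁, x₂ - x₁, y₃, y₄))
  rw [hcoords] at h4
  simp only [mapVec] at hnorm
  simp only [map_add, map_pow, map_mul, map_ofNat (GoldenInt.eval t hts) 4] at h4 ⊢
  have hpow : (4 : ℝ) ^ n = (2 ^ n) ^ 2 := by rw [← pow_mul, mul_comm, pow_mul]; norm_num
  rw [← hnorm] at h4
  rw [hpow]
  linear_combination -h4 / 4

theorem mem_rootGroup_of_smul_eq_vecQ (n : ℕ) : ∀ (t : ℝ) (_ : t = gr ∨ t = 1 - gr)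
    (hts : t ^ 2 = t + 1) (q : (Quaternion ℝ)ˣ), Quaternion.normSq (q : Quaternion ℝ) = 1 →
    ∀ x, (2 ^ n : ℝ) • (q : Quaternion ℝ) = vecQ (mapVec (GoldenInt.eval t hts) x) →
      q ∈ rootGroup := by
  induction n with
  | zero =>
    intro t ht hts q hq x hx
    rw [pow_zero, one_smul] at hx
    apply mem_rootGroup ht
    rw [hx]
    apply vecQ_mem_DeltaQ_of_sum_sq
    apply GoldenInt.eval_injective t hts
    rw [hx, normSq_vecQ] at hq
    simpa [mapVec] using hq
  | succ n ih =>
    rintro t ht hts q hq ⟨x₁, x₂, x₃, x₄⟩ hx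
    have hsum : x₁ ^ 2 + x₂ ^ 2 + x₃ ^ 2 + x₄ ^ 2 = 4 * 4 ^ n := by
      apply GoldenInt.eval_injective t hts
      have hnorm := congrArg Quaternion.normSq hx
      rw [normSq_vecQ, Quaternion.normSq_smul, hq] at hnorm
      simp only [mapVec] at hnorm
      simp only [map_add, map_pow, map_mul, map_ofNat (GoldenInt.eval t hts) 4]
      have hpow : (4 : ℝ) ^ n = (2 ^ n) ^ 2 := by rw [← pow_mul, mul_comm, pow_mul]; norm_num
      rw [← hnorm, hpow]
      ring
    rcases GoldenInt.red_eq_of_four_dvd x₁ x₂ x₃ x₄ _ hsum with ⟨h₃, h₄⟩ | ⟨h₃, h₄⟩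
    · exact mem_rootGroup_of_red_eq ht hts n (ih t ht hts) q hq x₁ x₂ x₃ x₄ hx h₃ h₄
    · have ht' : 1 - t = gr ∨ 1 - t = 1 - gr := by
        rcases ht with rfl | rfl
        exacts [Or.inr rfl, Or.inl (by ring)]
      have hts' : (1 - t) ^ 2 = 1 - t + 1 := by linear_combination hts
      have hstar : ∀ x y : GoldenInt, GoldenInt.red x = GoldenInt.red y →
          GoldenInt.red (star x) = GoldenInt.red (star y) := by
        intro x y h
        obtain ⟨z, hz⟩ := GoldenInt.exists_eq_two_mul (x - y) (by rw [map_sub, h, sub_self])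
        have h2 : GoldenInt.red 2 = 0 := by decide
        rw [← sub_eq_zero, ← map_sub, ← star_sub, hz, two_mul, star_add, ← two_mul, map_mul, h2,
          zero_mul]
      refine mem_rootGroup_of_red_eq ht' hts' n (ih (1 - t) ht' hts') q hq
        (star x₁) (star x₂) (star x₃) (star x₄) ?_ ?_ ?_
      · rw [hx]
        simp only [mapVec, GoldenInt.eval_star t (1 - t) hts hts' rfl]
      · rw [hstar _ _ h₃, star_add, star_mul', star_sub, GoldenInt.star_tau]
      · rw [hstar _ _ h₄, star_add, star_mul', star_sub, star_sub, GoldenInt.star_tau, star_one,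
          sub_sub_cancel]

theorem exists_smul_eq_vecQ {q : Quaternion ℝ} (hq : q ∈ SigmaQ) :
    ∃ (n : ℕ) (x : GoldenInt × GoldenInt × GoldenInt × GoldenInt),
      (2 ^ n : ℝ) • q = vecQ (mapVec (GoldenInt.eval gr gr_sq) x) := by
  obtain ⟨-, h₁, h₂, h₃, h₄⟩ := hq
  obtain ⟨x₁, n₁, h₁⟩ := (mem_Rgold_iff _).1 h₁
  obtain ⟨x₂, n₂, h₂⟩ := (mem_Rgold_iff _).1 h₂
  obtain ⟨x₃, n₃, h₃⟩ := (mem_Rgold_iff _).1 h₃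
  obtain ⟨x₄, n₄, h₄⟩ := (mem_Rgold_iff _).1 h₄
  refine ⟨n₁ + n₂ + n₃ + n₄, (2 ^ (n₂ + n₃ + n₄) * x₁, 2 ^ (n₁ + n₃ + n₄) * x₂,
    2 ^ (n₁ + n₂ + n₄) * x₃, 2 ^ (n₁ + n₂ + n₃) * x₄), ?_⟩
  ext <;> simp only [Quaternion.re_smul, Quaternion.imI_smul, Quaternion.imJ_smul,
    Quaternion.imK_smul, smul_eq_mul, h₁, h₂, h₃, h₄] <;>
    simp only [vecQ, mapVec, map_mul, map_pow, map_ofNat (GoldenInt.eval gr gr_sq) 2] <;>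
    field_simp <;> ring

theorem sigmaSubgroup_eq_rootGroup : sigmaSubgroup = rootGroup := by
  refine le_antisymm (fun u hu => ?_) rootGroup_le_sigmaSubgroup
  obtain ⟨n, x, hx⟩ := exists_smul_eq_vecQ hu
  exact mem_rootGroup_of_smul_eq_vecQ n gr (Or.inl rfl) gr_sq u
    ((norm_eq_one_iff_normSq _).1 hu.1) x hx

end Icosian

theorem statement15 :
    (1 ∈ SigmaQ) ∧
    (∀ x ∈ SigmaQ, ∀ y ∈ SigmaQ, x * y ∈ SigmaQ) ∧
    (∀ x ∈ SigmaQ, x⁻¹ ∈ SigmaQ) ∧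
    SigmaQ = (fun u : (Quaternion ℝ)ˣ => (u : Quaternion ℝ)) ''
      (Subgroup.closure {u : (Quaternion ℝ)ˣ |
        (u : Quaternion ℝ) ∈ DeltaQ gr ∪ DeltaQ (1 - gr)} : Subgroup (Quaternion ℝ)ˣ) := by
  refine ⟨one_mem_SigmaQ, fun x hx y hy => mul_mem_SigmaQ hx hy, fun x hx => inv_mem_SigmaQ hx, ?_⟩
  change SigmaQ = (fun u : (Quaternion ℝ)ˣ => (u : Quaternion ℝ)) '' (rootGroup : Set _)
  rw [← Icosian.sigmaSubgroup_eq_rootGroup]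
  ext q
  constructor
  · intro hq
    have hne : q ≠ 0 := by
      rintro rfl
      simpa using hq.1
    exact ⟨Units.mk0 q hne, hq, rfl⟩
  · rintro ⟨u, hu, rfl⟩
    exact hu
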